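/- Let A be an MPS tensor that is injective with injectivity length L and admits positive definite transfer fixed points ρ_L, ρ_R. Let o be a k-site operator (k ≥ 1), let N > 2L + 2k − 1, and suppose O_N ψ_N = E_N ψ_N for some E_N ∈ ℂ. Then for every K ≥ k, the matrix product state ψ_K on K sites satisfies O_K ψ_K = (K · E_N / N) ψ_K; i.e., the eigenstate property at one system size implies it at every system size, with extensive eigenvalue E_K = (E_N/N)·K. -/

import Mathlib

open Matrix
open scoped ComplexOrder

/-- Cyclic shift of a site index: `cyc a t` is `a + t (mod N)`. -/
def cyc {N : ℕ} (a : Fin N) (t : ℕ) : Fin N :=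
  ⟨(a.val + t) % N, Nat.mod_lt _ (Nat.lt_of_le_of_lt (Nat.zero_le _) a.isLt)⟩

/-- Ordered product `A^{i_1} ⋯ A^{i_m}`. -/
noncomputable def prodA {d D m : ℕ} (A : Fin d → Matrix (Fin D) (Fin D) ℂ)
    (i : Fin m → Fin d) : Matrix (Fin D) (Fin D) ℂ :=
  (List.ofFn fun t => A (i t)).prod

/-- Matrix product state on `N` cyclic sites:
`ψ_N(i_1,…,i_N) = Tr(A^{i_1} ⋯ A^{i_N})`. -/
noncomputable def mps {d D : ℕ} (A : Fin d → Matrix (Fin D) (Fin D) ℂ) (N : ℕ) :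
    (Fin N → Fin d) → ℂ :=
  fun i => (prodA A i).trace

/-- A `k`-site operator `o` acting on sites `n, n+1, …, n+k-1 (mod N)` of a
periodic chain of `N` sites, as a matrix on the full configuration space. -/
noncomputable def localOp {d k N : ℕ}
    (o : Matrix (Fin k → Fin d) (Fin k → Fin d) ℂ) (n : Fin N) :
    Matrix (Fin N → Fin d) (Fin N → Fin d) ℂ :=
  Matrix.of fun x y =>
    o (fun t => x (cyc n t.val)) (fun t => y (cyc n t.val)) *
      (if ∀ m : Fin N, (∀ t : Fin k, m ≠ cyc n t.val) → x m = y m then 1 else 0)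

/-- `O_N = Σ_{n=1}^N o_n`, the sum of all translates of a `k`-site operator. -/
noncomputable def opSum {d k N : ℕ}
    (o : Matrix (Fin k → Fin d) (Fin k → Fin d) ℂ) :
    Matrix (Fin N → Fin d) (Fin N → Fin d) ℂ :=
  ∑ n : Fin N, localOp o n

/-- `A` is injective with injectivity length `L`: the map
`Γ_L : X ↦ (Tr(X A^{i_1} ⋯ A^{i_L}))_{i}` is injective. -/
noncomputable def InjectiveLen {d D : ℕ} (A : Fin d → Matrix (Fin D) (Fin D) ℂ)
    (L : ℕ) : Prop :=
  Function.Injective fun X : Matrix (Fin D) (Fin D) ℂ =>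
    fun i : Fin L → Fin d => (X * prodA A i).trace

/-- `ρL, ρR` are positive definite fixed points of the transfer operator of `A`. -/
def TransferFixedPoints {d D : ℕ} (A : Fin d → Matrix (Fin D) (Fin D) ℂ)
    (ρL ρR : Matrix (Fin D) (Fin D) ℂ) : Prop :=
  ρL.PosDef ∧ ρR.PosDef ∧
    (∑ i, (A i)ᴴ * ρL * A i) = ρL ∧ (∑ i, A i * ρR * (A i)ᴴ) = ρR

/-- `B` satisfies the local telescoping equation for `(A, o, ε)`, where `o` is a
`(k+1)`-site operator and `B` is a family of matrices indexed by `k`-tuples: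
`Σ_j o^{i}_{j} A^{j_0}⋯A^{j_k} − ε A^{i_0}⋯A^{i_k}
  = A^{i_0} B^{i_1…i_k} − B^{i_0…i_{k-1}} A^{i_k}`. -/
noncomputable def Telescopes {d D k : ℕ} (A : Fin d → Matrix (Fin D) (Fin D) ℂ)
    (o : Matrix (Fin (k+1) → Fin d) (Fin (k+1) → Fin d) ℂ) (ε : ℂ)
    (B : (Fin k → Fin d) → Matrix (Fin D) (Fin D) ℂ) : Prop :=
  ∀ i : Fin (k+1) → Fin d,
    (∑ j : Fin (k+1) → Fin d, o i j • prodA A j) - ε • prodA A i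
      = A (i 0) * B (fun t => i t.succ) - B (fun t => i t.castSucc) * A (i (Fin.last k))

section Words

variable {d D : ℕ} (A : Fin d → Matrix (Fin D) (Fin D) ℂ)

/-- The product of the MPS matrices along a word. -/
noncomputable def wordProd (l : List (Fin d)) : Matrix (Fin D) (Fin D) ℂ :=
  (l.map A).prod

@[simp] lemma wordProd_nil : wordProd A [] = 1 := by simp [wordProd]

@[simp] lemma wordProd_cons (x : Fin d) (l : List (Fin d)) :
    wordProd A (x :: l) = A x * wordProd A l := by simp [wordProd]

@[simp] lemma wordProd_append (l m : List (Fin d)) :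
    wordProd A (l ++ m) = wordProd A l * wordProd A m := by simp [wordProd]

lemma prodA_eq_wordProd {m : ℕ} (i : Fin m → Fin d) :
    prodA A i = wordProd A (List.ofFn i) := by
  simp [prodA, wordProd, List.map_ofFn, Function.comp_def]

lemma trace_wordProd_rotate (l : List (Fin d)) (s : ℕ) :
    (wordProd A (l.rotate s)).trace = (wordProd A l).trace := by
  rw [List.rotate_eq_drop_append_take_mod, wordProd_append, Matrix.trace_mul_comm,
    ← wordProd_append, List.take_append_drop]

/-- The contribution to the ring sum of the window at the start of the word `l`. -/
noncomputable def headTerm (k : ℕ) (C : List (Fin d) → Matrix (Fin D) (Fin D) ℂ)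
    (l : List (Fin d)) : ℂ :=
  (C (l.take (k + 1)) * wordProd A (l.drop (k + 1))).trace

/-- The sum over all cyclic translates of the insertion of `C` into a window of `k + 1` sites. -/
noncomputable def ringSum (k : ℕ) (C : List (Fin d) → Matrix (Fin D) (Fin D) ℂ)
    (l : List (Fin d)) : ℂ :=
  ∑ s ∈ Finset.range l.length, headTerm A k C (l.rotate s)

/-- The sum over all insertions of `C` into the windows of `k + 1` sites of an open word. -/
noncomputable def openSum (k : ℕ) (C : List (Fin d) → Matrix (Fin D) (Fin D) ℂ)
    (l : List (Fin d)) : Matrix (Fin D) (Fin D) ℂ :=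
  ∑ s ∈ Finset.range (l.length - k),
    wordProd A (l.take s) * C ((l.drop s).take (k + 1)) * wordProd A (l.drop (s + k + 1))

lemma openSum_cons (k : ℕ) (C : List (Fin d) → Matrix (Fin D) (Fin D) ℂ)
    (x : Fin d) (l : List (Fin d)) (h : k ≤ l.length) :
    openSum A k C (x :: l) =
      C (x :: l.take k) * wordProd A (l.drop k) + A x * openSum A k C l := by
  have e : (x :: l).length - k = (l.length - k) + 1 := by simp; omega
  rw [openSum, e, Finset.sum_range_succ', add_comm, openSum, Finset.mul_sum]
  congr 1
  · simp
  · refine Finset.sum_congr rfl fun s _ => ?_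
    rw [show s + 1 + k + 1 = (s + k + 1) + 1 by ring]
    simp [mul_assoc]

lemma sum_headTerm_rotate_append (k : ℕ) (C : List (Fin d) → Matrix (Fin D) (Fin D) ℂ)
    (u v : List (Fin d)) :
    ∑ s ∈ Finset.range (u.length - k), headTerm A k C ((u ++ v).rotate s) =
      (openSum A k C u * wordProd A v).trace := by
  rw [openSum, Finset.sum_mul, Matrix.trace_sum]
  refine Finset.sum_congr rfl fun s hs => ?_
  have hs' : s + (k + 1) ≤ u.length := by
    have := Finset.mem_range.1 hs
    omega
  rw [headTerm, List.rotate_eq_drop_append_take (by simp; omega),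
    List.drop_append_of_le_length (l₁ := u) (by omega),
    List.take_append_of_le_length (l₁ := u) (by omega), List.append_assoc,
    List.take_append_of_le_length (by simp; omega),
    List.drop_append_of_le_length (by simp; omega), List.drop_drop, ← add_assoc]
  simp only [wordProd_append, ← mul_assoc]
  rw [Matrix.trace_mul_comm]
  simp only [← mul_assoc]

lemma ringSum_split (k : ℕ) (C : List (Fin d) → Matrix (Fin D) (Fin D) ℂ)
    (p m q w : List (Fin d)) (hp : p.length = k) (hq : q.length = k) :
    ringSum A k C (p ++ m ++ q ++ w) =
      (openSum A k C (p ++ m ++ q) * wordProd A w).trace +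
        (wordProd A m * openSum A k C (q ++ w ++ p)).trace := by
  have e : (p ++ m ++ q ++ w).length = ((p ++ m ++ q).length - k) + ((q ++ w ++ p).length - k) := by
    simp only [List.length_append]; omega
  rw [ringSum, e, Finset.range_eq_Ico, ← Finset.sum_Ico_consecutive _ (Nat.zero_le _)
    (Nat.le_add_right _ _), ← Finset.range_eq_Ico, Finset.sum_Ico_eq_sum_range,
    Nat.add_sub_cancel_left, sum_headTerm_rotate_append]
  refine congrArg₂ (· + ·) rfl ?_
  rw [Matrix.trace_mul_comm, ← sum_headTerm_rotate_append]
  refine Finset.sum_congr rfl fun s _ => ?_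
  rw [← List.rotate_rotate]
  have e2 : (p ++ m ++ q).length - k = (p ++ m).length := by
    simp only [List.length_append]; omega
  rw [e2, List.append_assoc (p ++ m), List.rotate_append_length_eq]
  simp only [List.append_assoc]

end Words

section Injective

variable {d D : ℕ} {A : Fin d → Matrix (Fin D) (Fin D) ℂ} {L : ℕ}

lemma exists_ofFn_eq {α : Type*} {l : List α} {n : ℕ} (h : l.length = n) :
    ∃ i : Fin n → α, List.ofFn i = l := by
  subst h
  exact ⟨l.get, List.ofFn_get l⟩

lemma InjectiveLen.eq_zero (h : InjectiveLen A L) {X : Matrix (Fin D) (Fin D) ℂ}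
    (hX : ∀ w : List (Fin d), w.length = L → (X * wordProd A w).trace = 0) : X = 0 := by
  apply h
  funext i
  simp [prodA_eq_wordProd, hX]

lemma InjectiveLen.succ {V : Fin d → Matrix (Fin D) (Fin D) ℂ} (hV : ∑ x, V x * A x = 1)
    (h : InjectiveLen A L) : InjectiveLen A (L + 1) := by
  intro X Y hXY
  rw [← sub_eq_zero]
  have hz : ∀ x, A x * (X - Y) = 0 := fun x => h.eq_zero fun w hw => by
    obtain ⟨i, hi⟩ := exists_ofFn_eq (l := w ++ [x]) (n := L + 1) (by simp [hw])
    have := congrFun hXY i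
    simp only [prodA_eq_wordProd, hi] at this
    rw [mul_assoc, Matrix.trace_mul_comm, mul_assoc, Matrix.sub_mul, Matrix.trace_sub, sub_eq_zero]
    simpa using this
  calc X - Y = (∑ x, V x * A x) * (X - Y) := by rw [hV, one_mul]
    _ = 0 := by simp [Finset.sum_mul, mul_assoc, hz]

lemma InjectiveLen.mono {V : Fin d → Matrix (Fin D) (Fin D) ℂ} (hV : ∑ x, V x * A x = 1)
    (h : InjectiveLen A L) {n : ℕ} (hn : L ≤ n) : InjectiveLen A n := by
  induction n, hn using Nat.le_induction with
  | base => exact h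
  | succ n _ ih => exact ih.succ hV

/-- Injectivity yields a frame dual to the word products. -/
lemma InjectiveLen.exists_frame (h : InjectiveLen A L) :
    ∃ S : (Fin L → Fin d) → Matrix (Fin D) (Fin D) ℂ,
      (∀ X, ∑ w, (X * wordProd A (List.ofFn w)).trace • S w = X) ∧
      ∀ X, ∑ w, (X * S w).trace • wordProd A (List.ofFn w) = X := by
  let Γ : Matrix (Fin D) (Fin D) ℂ →ₗ[ℂ] ((Fin L → Fin d) → ℂ) :=
    { toFun := fun X w => (X * prodA A w).trace
      map_add' := fun X Y => by ext w; simp [add_mul]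
      map_smul' := fun c X => by ext w; simp }
  obtain ⟨R, hR⟩ := Γ.exists_leftInverse_of_injective (LinearMap.ker_eq_bot.2 h)
  have h1 : ∀ X, ∑ w, (X * wordProd A (List.ofFn w)).trace • R (Pi.single w 1) = X := fun X => by
    have := LinearMap.congr_fun hR X
    simp only [LinearMap.comp_apply, LinearMap.id_apply] at this
    have hΓ : Γ X = ∑ w, Γ X w • Pi.single w (1 : ℂ) := by
      ext w
      simp [Finset.sum_apply, Pi.single_apply]
    rw [hΓ] at this
    simpa [Γ, prodA_eq_wordProd] using this
  refine ⟨fun w => R (Pi.single w 1), h1, fun Y => ?_⟩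
  refine Matrix.ext_iff_trace_mul_left.2 fun X => ?_
  conv_rhs => rw [← h1 X]
  simp only [Finset.mul_sum, Finset.sum_mul, Matrix.trace_sum, Matrix.mul_smul, Matrix.smul_mul,
    Matrix.trace_smul, smul_eq_mul]
  refine Finset.sum_congr rfl fun w _ => ?_
  rw [mul_comm, Matrix.trace_mul_comm Y]

lemma InjectiveLen.linearMap_ext (h : InjectiveLen A L) {M : Type*} [AddCommMonoid M] [Module ℂ M]
    {f g : Matrix (Fin D) (Fin D) ℂ →ₗ[ℂ] M}
    (hfg : ∀ w : List (Fin d), w.length = L → f (wordProd A w) = g (wordProd A w)) : f = g := by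
  obtain ⟨S, -, hS⟩ := h.exists_frame
  ext1 X
  rw [← hS X]
  simp [hfg]

end Injective

section Reduction

variable {d D : ℕ} {A : Fin d → Matrix (Fin D) (Fin D) ℂ} {L : ℕ}

lemma exists_openSum_eq_linearMap {k N r n : ℕ} {C : List (Fin d) → Matrix (Fin D) (Fin D) ℂ}
    (hinj : InjectiveLen A n) (hN : N = 2 * k + r + n)
    (hring : ∀ l : List (Fin d), l.length = N → ringSum A k C l = 0)
    {p q : List (Fin d)} (hp : p.length = k) (hq : q.length = k) :
    ∃ G : Matrix (Fin D) (Fin D) ℂ →ₗ[ℂ] Matrix (Fin D) (Fin D) ℂ,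
      ∀ m : List (Fin d), m.length = r → openSum A k C (p ++ m ++ q) = G (wordProd A m) := by
  obtain ⟨S, hS, -⟩ := hinj.exists_frame
  refine ⟨{ toFun := fun X =>
              -∑ w, (X * openSum A k C (q ++ List.ofFn w ++ p)).trace • S w
            map_add' := fun X Y => by
              simp only [add_mul, Matrix.trace_add, add_smul, Finset.sum_add_distrib, neg_add]
            map_smul' := fun c X => by
              simp [Finset.smul_sum, mul_smul] }, fun m hm => ?_⟩
  rw [← hS (openSum A k C (p ++ m ++ q))]
  simp only [LinearMap.coe_mk, AddHom.coe_mk, ← Finset.sum_neg_distrib, ← neg_smul]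
  refine Finset.sum_congr rfl fun w _ => ?_
  congr 1
  rw [eq_neg_iff_add_eq_zero, ← ringSum_split A k C p m q _ hp hq]
  exact hring _ (by simp only [List.length_append, List.length_ofFn]; omega)

lemma exists_sum_wordProd_mul_eq_one {U : Fin d → Matrix (Fin D) (Fin D) ℂ}
    (hU : ∑ x, A x * U x = 1) (n : ℕ) :
    ∃ X : (Fin n → Fin d) → Matrix (Fin D) (Fin D) ℂ,
      ∑ w, wordProd A (List.ofFn w) * X w = 1 := by
  induction n with
  | zero => exact ⟨fun _ => 1, by simp⟩
  | succ n ih =>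
    obtain ⟨X, hX⟩ := ih
    refine ⟨fun w => X (Fin.tail w) * U (w 0), ?_⟩
    rw [← (Fin.consEquiv fun _ => Fin d).sum_comp, Fintype.sum_prod_type]
    have e : ∀ (x : Fin d) (w : Fin n → Fin d),
        Fin.consEquiv (fun _ => Fin d) (x, w) = (Fin.cons x w : Fin (n + 1) → Fin d) :=
      fun _ _ => rfl
    simp only [e, List.ofFn_succ, Fin.cons_zero, Fin.cons_succ, Fin.tail_cons, wordProd_cons,
      mul_assoc]
    rw [← hU]
    refine Finset.sum_congr rfl fun x _ => ?_
    rw [← Finset.mul_sum]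
    simp only [← mul_assoc]
    rw [← Finset.sum_mul, hX, one_mul]

/-- A window of `k + 2` sites whose ring sum vanishes decouples at its two ends. -/
lemma exists_decoupling {U : Fin d → Matrix (Fin D) (Fin D) ℂ}
    (hU : ∑ x, A x * U x = 1) {k N n : ℕ} {C : List (Fin d) → Matrix (Fin D) (Fin D) ℂ}
    (hinj : InjectiveLen A L) (hinj' : InjectiveLen A n)
    (hN : N = 2 * (k + 1) + (L + 1) + n)
    (hring : ∀ l : List (Fin d), l.length = N → ringSum A (k + 1) C l = 0) :
    ∃ B B' : List (Fin d) → Matrix (Fin D) (Fin D) ℂ,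
      ∀ (x : Fin d) (u : List (Fin d)) (y : Fin d), u.length = k →
        C (x :: (u ++ [y])) = A x * B (u ++ [y]) + B' (x :: u) * A y := by
  obtain ⟨S, -, hS⟩ := hinj.exists_frame
  obtain ⟨Z, hZ⟩ := exists_sum_wordProd_mul_eq_one hU (k + 1)
  let Δ : List (Fin d) → List (Fin d) → Matrix (Fin D) (Fin D) ℂ → Matrix (Fin D) (Fin D) ℂ :=
    fun l q X => ∑ w, (X * S w).trace • openSum A (k + 1) C (l ++ List.ofFn w ++ q)
  refine ⟨fun l => ∑ q, (∑ z, Δ (l.take k ++ [z]) (List.ofFn q) (U z * wordProd A (l.drop k))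
      - Δ l (List.ofFn q) 1) * Z q, fun l => ∑ z, C (l ++ [z]) * U z, fun x u y hu => ?_⟩
  have key : ∀ q : Fin (k + 1) → Fin d,
      ∃ G : Matrix (Fin D) (Fin D) ℂ →ₗ[ℂ] Matrix (Fin D) (Fin D) ℂ, ∀ z X,
        C (x :: (u ++ [z])) * X * wordProd A (List.ofFn q) + A x * Δ (u ++ [z]) (List.ofFn q) X =
          G (A z * X) := by
    intro q
    obtain ⟨G, hG⟩ := exists_openSum_eq_linearMap (r := L + 1) hinj' hN hring
      (p := x :: u) (q := List.ofFn q) (by simp [hu]) (by simp)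
    refine ⟨G, fun z X => ?_⟩
    conv_rhs => rw [← hS X]
    conv_lhs => enter [1, 1, 2]; rw [← hS X]
    simp only [Δ, Finset.mul_sum, Finset.sum_mul, map_sum, ← Finset.sum_add_distrib,
      Matrix.mul_smul, Matrix.smul_mul, map_smul, ← smul_add]
    refine Finset.sum_congr rfl fun w _ => ?_
    have h := hG (z :: List.ofFn w) (by simp)
    rw [wordProd_cons] at h
    rw [← h]
    have e : x :: u ++ z :: List.ofFn w ++ List.ofFn q =
        x :: ((u ++ [z]) ++ (List.ofFn w ++ List.ofFn q)) := by simp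
    have hl : (u ++ [z]).length = k + 1 := by simp [hu]
    rw [e, openSum_cons _ _ _ _ _ (by simp only [List.length_append, List.length_ofFn]; omega),
      List.take_left' hl, List.drop_left' hl, wordProd_append]
    simp only [List.append_assoc, mul_assoc]
  have h1 : ∀ q : Fin (k + 1) → Fin d,
      C (x :: (u ++ [y])) * wordProd A (List.ofFn q) =
        (∑ z, C (x :: (u ++ [z])) * U z) * A y * wordProd A (List.ofFn q) +
          A x * (∑ z, Δ (u ++ [z]) (List.ofFn q) (U z * A y) - Δ (u ++ [y]) (List.ofFn q) 1) := by
    intro q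
    obtain ⟨G, hG⟩ := key q
    have e1 := hG y 1
    have e2 := Finset.sum_congr rfl fun z (_ : z ∈ Finset.univ) => hG z (U z * A y)
    simp only [← map_sum, ← mul_assoc] at e2
    rw [← Finset.sum_mul, hU, one_mul, Finset.sum_add_distrib, ← Finset.mul_sum] at e2
    rw [mul_one, mul_one, ← e2] at e1
    rw [mul_sub, Finset.sum_mul, Finset.sum_mul, ← add_sub_assoc, ← e1, add_sub_cancel_right]
  have hdrop : wordProd A ((u ++ [y]).drop k) = A y := by
    rw [← hu, List.drop_left]; simp
  have htake : (u ++ [y]).take k = u := by rw [← hu, List.take_left]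
  simp only [hdrop, htake, List.cons_append]
  calc C (x :: (u ++ [y])) = ∑ q, C (x :: (u ++ [y])) * wordProd A (List.ofFn q) * Z q := by
        simp only [mul_assoc]
        rw [← Finset.mul_sum, hZ, mul_one]
    _ = _ := by
        simp only [h1, add_mul, Finset.sum_add_distrib]
        rw [add_comm]
        congr 1
        · simp only [mul_assoc, ← Finset.mul_sum]
        · simp only [mul_assoc, ← Finset.mul_sum, hZ, mul_one]

lemma ringSum_eq_of_decoupling {k : ℕ} {C B B' : List (Fin d) → Matrix (Fin D) (Fin D) ℂ}
    (h : ∀ (x : Fin d) (u : List (Fin d)) (y : Fin d), u.length = k →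
        C (x :: (u ++ [y])) = A x * B (u ++ [y]) + B' (x :: u) * A y)
    {l : List (Fin d)} (hl : k + 2 ≤ l.length) :
    ringSum A (k + 1) C l = ringSum A k (fun w => B w + B' w) l := by
  have hhead : ∀ l : List (Fin d), k + 2 ≤ l.length →
      headTerm A (k + 1) C l = headTerm A k B (l.rotate 1) + headTerm A k B' l := by
    intro l hl
    obtain ⟨x, m, rfl⟩ := List.exists_cons_of_length_pos (l := l) (by omega)
    rw [List.length_cons] at hl
    obtain ⟨y, v, hv⟩ := List.exists_cons_of_length_pos (l := m.drop k) (by simp; omega)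
    obtain ⟨u, hu, rfl⟩ : ∃ u : List (Fin d), u.length = k ∧ m = u ++ y :: v :=
      ⟨m.take k, by simp; omega, by rw [← hv, List.take_append_drop]⟩
    subst hu
    simp only [headTerm, List.rotate_cons_succ, List.rotate_zero]
    simp [List.take_append, List.drop_append, List.take_of_length_le, List.drop_eq_nil_of_le, h,
      add_mul, mul_assoc]
    rw [Matrix.trace_mul_comm]
    simp [mul_assoc]
  have hshift : ∑ s ∈ Finset.range l.length, headTerm A k B ((l.rotate s).rotate 1) =
      ∑ s ∈ Finset.range l.length, headTerm A k B (l.rotate s) := by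
    have h1 := Finset.sum_range_succ (fun s => headTerm A k B (l.rotate s)) l.length
    rw [Finset.sum_range_succ', List.rotate_length, List.rotate_zero] at h1
    simpa only [List.rotate_rotate] using add_right_cancel h1
  rw [ringSum, Finset.sum_congr rfl fun s _ => hhead _ (by rw [List.length_rotate]; exact hl),
    Finset.sum_add_distrib, hshift, ← Finset.sum_add_distrib]
  simp [ringSum, headTerm, add_mul]

end Reduction

section OneSite

variable {d D : ℕ} {A : Fin d → Matrix (Fin D) (Fin D) ℂ} {L : ℕ}

lemma exists_eq_wordProd_mul {U V : Fin d → Matrix (Fin D) (Fin D) ℂ}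
    (hU : ∑ x, A x * U x = 1) (hV : ∑ x, V x * A x = 1) (n : ℕ)
    (h : Matrix (Fin D) (Fin D) ℂ → Matrix (Fin D) (Fin D) ℂ)
    (hh : ∀ x y X, h (A x * X) * A y = A x * h (X * A y)) :
    ∃ K, ∀ w : List (Fin d), w.length = n → h (wordProd A w) = wordProd A w * K := by
  induction n generalizing h with
  | zero => exact ⟨h 1, fun w hw => by simp [List.length_eq_zero_iff.1 hw]⟩
  | succ n ih =>
    let K : Matrix (Fin D) (Fin D) ℂ → Matrix (Fin D) (Fin D) ℂ :=
      fun X => ∑ y, h (X * A y) * U y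
    have h1 : ∀ x X, h (A x * X) = A x * K X := fun x X => by
      calc h (A x * X) = h (A x * X) * ∑ y, A y * U y := by rw [hU, mul_one]
        _ = A x * K X := by
          simp only [K, Finset.mul_sum, ← mul_assoc, hh]
    have h2 : ∀ y X, K X * A y = h (X * A y) := fun y X => by
      calc K X * A y = (∑ x, V x * A x) * (K X * A y) := by rw [hV, one_mul]
        _ = ∑ x, V x * (A x * h (X * A y)) := by
          simp only [Finset.sum_mul, mul_assoc]
          refine Finset.sum_congr rfl fun x _ => ?_
          rw [← mul_assoc (A x), ← h1, hh]
        _ = h (X * A y) := by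
          simp only [← mul_assoc, ← Finset.sum_mul, hV, one_mul]
    obtain ⟨K', hK'⟩ := ih K fun x y X => by rw [h2, mul_assoc, h1]
    refine ⟨K', fun w hw => ?_⟩
    obtain ⟨x, w, rfl⟩ := List.exists_cons_of_length_eq_add_one hw
    rw [wordProd_cons, h1, hK' w (by simpa using hw), mul_assoc]

lemma eq_smul_of_intertwining (hinj : InjectiveLen A L)
    {U V : Fin d → Matrix (Fin D) (Fin D) ℂ}
    (hU : ∑ x, A x * U x = 1) (hV : ∑ x, V x * A x = 1)
    (h : Matrix (Fin D) (Fin D) ℂ →ₗ[ℂ] Matrix (Fin D) (Fin D) ℂ)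
    (hh : ∀ x y X, h (A x * X) * A y = A x * h (X * A y)) :
    ∃ c : ℂ, ∀ X, h X = c • X := by
  obtain ⟨K, hK⟩ := exists_eq_wordProd_mul hU hV L h hh
  have h1 : ∀ X, h X = X * K := LinearMap.congr_fun
    (hinj.linearMap_ext (g := LinearMap.mulRight ℂ K) (by simpa using hK))
  have h2 : ∀ y, K * A y = A y * K := fun y => by
    calc K * A y = (∑ x, V x * A x) * (K * A y) := by rw [hV, one_mul]
      _ = ∑ x, V x * (A x * (1 * A y) * K) := by
        simp only [Finset.sum_mul]
        refine Finset.sum_congr rfl fun x _ => ?_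
        have := hh x y 1
        simp only [h1, mul_one, one_mul] at this
        simp only [mul_assoc, one_mul] at this ⊢
        rw [this]
      _ = A y * K := by
        simp only [one_mul, ← mul_assoc, ← Finset.sum_mul, hV]
  have h3 : ∀ w : List (Fin d), K * wordProd A w = wordProd A w * K := fun w => by
    induction w with
    | nil => simp
    | cons x w ih => rw [wordProd_cons, ← mul_assoc, h2, mul_assoc, ih, mul_assoc]
  have h4 : ∀ X, K * X = X * K := LinearMap.congr_fun
    (hinj.linearMap_ext (f := LinearMap.mulLeft ℂ K) (g := LinearMap.mulRight ℂ K)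
      fun w _ => h3 w)
  obtain ⟨c, hc⟩ := Matrix.mem_range_scalar_iff_commute_single'.2 fun i j => (h4 _).symm
  refine ⟨c, fun X => ?_⟩
  rw [h1, ← h4, ← hc]
  ext i j
  simp

lemma openSum_zero_concat (C : List (Fin d) → Matrix (Fin D) (Fin D) ℂ) (l : List (Fin d))
    (x : Fin d) :
    openSum A 0 C (l ++ [x]) = openSum A 0 C l * A x + wordProd A l * C [x] := by
  induction l with
  | nil => simp [openSum]
  | cons y l ih =>
    rw [List.cons_append, openSum_cons _ _ _ _ _ (Nat.zero_le _),
      openSum_cons _ _ _ _ _ (Nat.zero_le _), ih]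
    simp [mul_add, add_mul, mul_assoc, add_assoc]

lemma sum_map_mul_single_mul_single [NeZero D]
    (f : Matrix (Fin D) (Fin D) ℂ →ₗ[ℂ] Matrix (Fin D) (Fin D) ℂ) (M : Matrix (Fin D) (Fin D) ℂ) :
    ∑ i, f (M * Matrix.single i 0 1) * Matrix.single 0 i 1 =
      (∑ j, f (Matrix.single j 0 1) * Matrix.single 0 j 1) * M := by
  have h1 : ∀ i, M * Matrix.single i 0 1 = ∑ j, M j i • Matrix.single j (0 : Fin D) (1 : ℂ) := by
    intro i
    ext a b
    simp [Matrix.sum_apply, Matrix.single_apply, Matrix.mul_apply, ite_and]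
  have h2 : ∀ j, Matrix.single 0 j 1 * M = ∑ i, M j i • Matrix.single (0 : Fin D) i (1 : ℂ) := by
    intro j
    ext a b
    simp [Matrix.sum_apply, Matrix.single_apply, Matrix.mul_apply, ite_and]
  simp only [Finset.sum_mul, mul_assoc, h2, h1, map_sum, map_smul, Finset.mul_sum,
    Matrix.mul_smul, Matrix.smul_mul]
  exact Finset.sum_comm

lemma sum_single_mul_single [NeZero D] :
    ∑ i : Fin D, Matrix.single i 0 1 * Matrix.single 0 i 1 = (1 : Matrix (Fin D) (Fin D) ℂ) := by
  simp [Matrix.sum_single_one]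

/-- A one-site insertion whose ring sum vanishes is a commutator plus a multiple of `A`. -/
lemma exists_commutator_of_ringSum_eq_zero [NeZero D] (hinj : InjectiveLen A L)
    {U V : Fin d → Matrix (Fin D) (Fin D) ℂ}
    (hU : ∑ x, A x * U x = 1) (hV : ∑ x, V x * A x = 1)
    {N : ℕ} {C : List (Fin d) → Matrix (Fin D) (Fin D) ℂ} (hN : 2 * L + 2 ≤ N)
    (hring : ∀ l : List (Fin d), l.length = N → ringSum A 0 C l = 0) :
    ∃ (S : Matrix (Fin D) (Fin D) ℂ) (c : ℂ), ∀ x, C [x] = S * A x - A x * S + c • A x := by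
  have hG : ∀ r, r ≤ L + 2 → ∃ G : Matrix (Fin D) (Fin D) ℂ →ₗ[ℂ] Matrix (Fin D) (Fin D) ℂ,
      ∀ m : List (Fin d), m.length = r → openSum A 0 C m = G (wordProd A m) := fun r hr => by
    simpa using exists_openSum_eq_linearMap (A := A) (N := N) (r := r) (n := N - r) (k := 0)
      (hinj.mono hV (by omega)) (by omega) hring (p := []) (q := []) rfl rfl
  obtain ⟨G₀, h₀⟩ := hG L (by omega)
  obtain ⟨G₁, h₁⟩ := hG (L + 1) (by omega)
  obtain ⟨G₂, h₂⟩ := hG (L + 2) (by omega)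
  have hcons : ∀ (n : ℕ) (G G' : Matrix (Fin D) (Fin D) ℂ →ₗ[ℂ] Matrix (Fin D) (Fin D) ℂ),
      InjectiveLen A n →
      (∀ m : List (Fin d), m.length = n → openSum A 0 C m = G (wordProd A m)) →
      (∀ m : List (Fin d), m.length = n + 1 → openSum A 0 C m = G' (wordProd A m)) →
      ∀ x X, G' (A x * X) = C [x] * X + A x * G X := by
    intro n G G' hn h h' x
    refine LinearMap.congr_fun (f := G' ∘ₗ LinearMap.mulLeft ℂ (A x))
      (g := LinearMap.mulLeft ℂ (C [x]) + LinearMap.mulLeft ℂ (A x) ∘ₗ G)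
      (hn.linearMap_ext fun w hw => ?_)
    have := h' (x :: w) (by simp [hw])
    rw [openSum_cons _ _ _ _ _ (Nat.zero_le _), h w hw] at this
    simpa using this.symm
  have hsnoc : ∀ (n : ℕ) (G G' : Matrix (Fin D) (Fin D) ℂ →ₗ[ℂ] Matrix (Fin D) (Fin D) ℂ),
      InjectiveLen A n →
      (∀ m : List (Fin d), m.length = n → openSum A 0 C m = G (wordProd A m)) →
      (∀ m : List (Fin d), m.length = n + 1 → openSum A 0 C m = G' (wordProd A m)) →
      ∀ x X, G' (X * A x) = G X * A x + X * C [x] := by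
    intro n G G' hn h h' x
    refine LinearMap.congr_fun (f := G' ∘ₗ LinearMap.mulRight ℂ (A x))
      (g := LinearMap.mulRight ℂ (A x) ∘ₗ G + LinearMap.mulRight ℂ (C [x]))
      (hn.linearMap_ext fun w hw => ?_)
    have := h' (w ++ [x]) (by simp [hw])
    rw [openSum_zero_concat, h w hw] at this
    simpa using this.symm
  have hinj₁ := hinj.succ hV
  obtain ⟨c, hc⟩ := eq_smul_of_intertwining hinj hU hV (G₁ - G₀) fun x y X => by
    have e1 := hcons L _ _ hinj h₀ h₁ x X
    have e2 := hcons (L + 1) _ _ hinj₁ h₁ h₂ x (X * A y)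
    have e3 := hsnoc L _ _ hinj h₀ h₁ y X
    have e4 := hsnoc (L + 1) _ _ hinj₁ h₁ h₂ y (A x * X)
    rw [← mul_assoc, e4] at e2
    have e5 := hsnoc L _ _ hinj h₀ h₁ y (A x * X)
    have e6 := hcons L _ _ hinj h₀ h₁ x (X * A y)
    have e7 : (G₁ (A x * X) - G₀ (A x * X)) * A y - A x * (G₁ (X * A y) - G₀ (X * A y)) =
        (G₁ (A x * X) * A y + A x * X * C [y]) - (G₀ (A x * X) * A y + A x * X * C [y])
        - ((C [x] * (X * A y) + A x * G₁ (X * A y)) - (C [x] * (X * A y) + A x * G₀ (X * A y))) := by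
      noncomm_ring
    rw [e2, ← e5, ← e6, mul_assoc] at e7
    rw [← sub_eq_zero, LinearMap.sub_apply, LinearMap.sub_apply, e7, sub_self]
  have hc₁ : ∀ X, G₁ X = G₀ X + c • X := fun X => by
    rw [← hc X, LinearMap.sub_apply, add_sub_cancel]
  have hx : ∀ x X, G₀ (A x * X) = (C [x] - c • A x) * X + A x * G₀ X := fun x X => by
    have := hcons L _ _ hinj h₀ h₁ x X
    rw [hc₁, ← eq_sub_iff_add_eq] at this
    rw [this, sub_mul, Matrix.smul_mul]
    abel
  refine ⟨∑ j, G₀ (Matrix.single j 0 1) * Matrix.single 0 j 1, c, fun x => ?_⟩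
  rw [← sum_map_mul_single_mul_single]
  simp only [hx, add_mul, Finset.sum_add_distrib, mul_assoc, ← Finset.mul_sum]
  rw [sum_single_mul_single, mul_one]
  abel

lemma openSum_zero_eq_of_commutator {C : List (Fin d) → Matrix (Fin D) (Fin D) ℂ}
    {S : Matrix (Fin D) (Fin D) ℂ} {c : ℂ} (h : ∀ x, C [x] = S * A x - A x * S + c • A x)
    (l : List (Fin d)) :
    openSum A 0 C l =
      S * wordProd A l - wordProd A l * S + ((l.length : ℂ) * c) • wordProd A l := by
  induction l with
  | nil => simp [openSum]
  | cons x l ih =>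
    rw [openSum_cons _ _ _ _ _ (Nat.zero_le _), ih]
    simp only [List.take_zero, List.drop_zero, h, wordProd_cons, List.length_cons]
    push_cast
    rw [add_mul (l.length : ℂ), one_mul, add_smul]
    simp only [add_mul, sub_mul, mul_add, mul_sub, Matrix.smul_mul, Matrix.mul_smul, mul_assoc]
    abel

lemma ringSum_zero_eq_of_commutator {C : List (Fin d) → Matrix (Fin D) (Fin D) ℂ}
    {S : Matrix (Fin D) (Fin D) ℂ} {c : ℂ} (h : ∀ x, C [x] = S * A x - A x * S + c • A x)
    (l : List (Fin d)) :
    ringSum A 0 C l = (l.length : ℂ) * c * (wordProd A l).trace := by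
  have := sum_headTerm_rotate_append A 0 C l []
  simp only [List.append_nil, Nat.sub_zero, wordProd_nil, mul_one] at this
  rw [ringSum, this, openSum_zero_eq_of_commutator h, Matrix.trace_add, Matrix.trace_sub,
    Matrix.trace_mul_comm, sub_self, zero_add, Matrix.trace_smul, smul_eq_mul]

/-- If the ring sum of a window of `k + 1` sites vanishes on one sufficiently long ring, then it
vanishes on every ring that contains the window. -/
theorem ringSum_eq_zero [NeZero D] (hinj : InjectiveLen A L)
    {U V : Fin d → Matrix (Fin D) (Fin D) ℂ}
    (hU : ∑ x, A x * U x = 1) (hV : ∑ x, V x * A x = 1) {k N : ℕ}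
    {C : List (Fin d) → Matrix (Fin D) (Fin D) ℂ} (hN : 2 * L + 2 * k + 2 ≤ N)
    (hring : ∀ l : List (Fin d), l.length = N → ringSum A k C l = 0)
    {l : List (Fin d)} (hl : k + 1 ≤ l.length) : ringSum A k C l = 0 := by
  induction k generalizing C with
  | zero =>
    obtain ⟨S, c, hC⟩ := exists_commutator_of_ringSum_eq_zero hinj hU hV (by omega) hring
    have hc : c = 0 := by
      by_contra hc
      refine one_ne_zero (α := Matrix (Fin D) (Fin D) ℂ)
        ((hinj.mono hV (n := N) (by omega)).eq_zero fun w hw => ?_)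
      have := hring w hw
      rw [ringSum_zero_eq_of_commutator hC, hw] at this
      have hN0 : (N : ℂ) ≠ 0 := Nat.cast_ne_zero.2 (by omega)
      simpa [hc, hN0] using this
    simp [ringSum_zero_eq_of_commutator hC, hc]
  | succ k ih =>
    obtain ⟨B, B', hB⟩ := exists_decoupling (n := N - (2 * (k + 1) + (L + 1))) hU hinj
      (hinj.mono hV (by omega)) (by omega) hring
    rw [ringSum_eq_of_decoupling hB hl]
    refine ih (by omega) (fun w hw => ?_) (by omega)
    rw [← ringSum_eq_of_decoupling hB (by omega), hring w hw]

end OneSite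

section Chain

variable {d D : ℕ}

/-- The window matrices of the operator `o`, with the multiple `ε` of the identity subtracted. -/
noncomputable def windowMatrix (A : Fin d → Matrix (Fin D) (Fin D) ℂ) {k : ℕ} (z : Fin d)
    (o : Matrix (Fin (k+1) → Fin d) (Fin (k+1) → Fin d) ℂ) (ε : ℂ) (l : List (Fin d)) :
    Matrix (Fin D) (Fin D) ℂ :=
  (∑ j : Fin (k+1) → Fin d, o (fun t => l.getD t.val z) j • prodA A j) - ε • wordProd A l

/-- The configuration `x` with the window of `k + 1` sites starting at `n` replaced by `j`. -/
def replaceWindow {k N : ℕ} (n : Fin N) (x : Fin N → Fin d) (j : Fin (k+1) → Fin d) :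
    Fin N → Fin d :=
  fun m => if h : (m.val + N - n.val) % N < k + 1 then j ⟨_, h⟩ else x m

lemma cyc_sub_mod {N : ℕ} (n : Fin N) {t : ℕ} (ht : t < N) :
    ((cyc n t).val + N - n.val) % N = t := by
  have hn := n.isLt
  simp only [cyc]
  rcases lt_or_ge (n.val + t) N with h | h
  · rw [Nat.mod_eq_of_lt h, show n.val + t + N - n.val = t + N by omega, Nat.add_mod_right,
      Nat.mod_eq_of_lt ht]
  · rw [Nat.mod_eq_sub_mod h, Nat.mod_eq_of_lt (a := n.val + t - N) (by omega),
      show n.val + t - N + N - n.val = t by omega, Nat.mod_eq_of_lt ht]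

lemma cyc_sub_mod_self {N : ℕ} (n m : Fin N) : cyc n ((m.val + N - n.val) % N) = m := by
  have hn := n.isLt
  have hm := m.isLt
  ext
  simp only [cyc]
  rw [Nat.add_mod_mod, show n.val + (m.val + N - n.val) = m.val + N by omega, Nat.add_mod_right,
    Nat.mod_eq_of_lt hm]

lemma replaceWindow_cyc {k N : ℕ} (hk : k + 1 ≤ N) (n : Fin N) (x : Fin N → Fin d)
    (j : Fin (k+1) → Fin d) (t : Fin (k+1)) : replaceWindow n x j (cyc n t.val) = j t := by
  have h := cyc_sub_mod n (lt_of_lt_of_le t.isLt hk)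
  have h' : ((cyc n t.val).val + N - n.val) % N < k + 1 := by rw [h]; exact t.isLt
  rw [replaceWindow, dif_pos h']
  congr 1
  exact Fin.ext h

lemma replaceWindow_of_ne {k N : ℕ} (n : Fin N) (x : Fin N → Fin d) (j : Fin (k+1) → Fin d)
    {m : Fin N} (hm : ∀ t : Fin (k+1), m ≠ cyc n t.val) : replaceWindow n x j m = x m := by
  rw [replaceWindow, dif_neg fun h => hm ⟨_, h⟩ (cyc_sub_mod_self n m).symm]

lemma getElem_rotate_ofFn {N : ℕ} (n : Fin N) (x : Fin N → Fin d) (t : ℕ)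
    (h : t < ((List.ofFn x).rotate n.val).length) :
    ((List.ofFn x).rotate n.val)[t] = x (cyc n t) := by
  simp [List.getElem_rotate, cyc, add_comm]

lemma rotate_ofFn_replaceWindow {k N : ℕ} (hk : k + 1 ≤ N) (n : Fin N) (x : Fin N → Fin d)
    (j : Fin (k+1) → Fin d) :
    (List.ofFn (replaceWindow n x j)).rotate n.val =
      List.ofFn j ++ ((List.ofFn x).rotate n.val).drop (k + 1) := by
  apply List.ext_getElem
  · simp; omega
  intro t h1 h2
  have htN : t < N := by simpa using h1
  rw [getElem_rotate_ofFn]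
  rcases lt_or_ge t (k + 1) with ht | ht
  · rw [List.getElem_append_left (by simpa using ht), List.getElem_ofFn]
    exact replaceWindow_cyc hk n x j ⟨t, ht⟩
  · rw [List.getElem_append_right (by simpa using ht), List.getElem_drop, getElem_rotate_ofFn,
      replaceWindow_of_ne]
    · congr 2
      simp; omega
    · intro s hs
      have := cyc_sub_mod n htN
      rw [hs, cyc_sub_mod n (lt_of_lt_of_le s.isLt hk)] at this
      have := s.isLt
      omega

lemma localOp_mulVec_mps (A : Fin d → Matrix (Fin D) (Fin D) ℂ) {k N : ℕ} (hk : k + 1 ≤ N)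
    (z : Fin d) (o : Matrix (Fin (k+1) → Fin d) (Fin (k+1) → Fin d) ℂ) (ε : ℂ) (n : Fin N)
    (x : Fin N → Fin d) :
    (localOp o n).mulVec (mps A N) x =
      headTerm A k (windowMatrix A z o ε) ((List.ofFn x).rotate n.val) + ε * mps A N x := by
  have hhead : headTerm A k (windowMatrix A z o ε) ((List.ofFn x).rotate n.val) + ε * mps A N x =
      ∑ j, o (fun t => x (cyc n t.val)) j * mps A N (replaceWindow n x j) := by
    have hget : ∀ t : Fin (k+1),
        (((List.ofFn x).rotate n.val).take (k + 1)).getD t.val z = x (cyc n t.val) := fun t => by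
      rw [List.getD_eq_getElem _ _ (by simp; omega), List.getElem_take, getElem_rotate_ofFn]
    have hmps : ∀ j, mps A N (replaceWindow n x j) =
        (prodA A j * wordProd A (((List.ofFn x).rotate n.val).drop (k + 1))).trace := fun j => by
      rw [mps, prodA_eq_wordProd, ← trace_wordProd_rotate _ _ n.val,
        rotate_ofFn_replaceWindow hk, wordProd_append, ← prodA_eq_wordProd]
    simp only [headTerm, windowMatrix, hget, hmps, sub_mul, Matrix.trace_sub, Matrix.smul_mul,
      ← wordProd_append, List.take_append_drop, Matrix.trace_smul, trace_wordProd_rotate,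
      Finset.sum_mul, Matrix.trace_sum, smul_eq_mul]
    rw [mps, prodA_eq_wordProd A x, sub_add_cancel]
  rw [hhead, Matrix.mulVec, dotProduct]
  symm
  refine Fintype.sum_of_injective (replaceWindow n x) (fun j j' h => ?_) _ _ (fun y hy => ?_)
    fun j => ?_
  · ext1 t
    rw [← replaceWindow_cyc hk n x j, h, replaceWindow_cyc hk]
  · rw [localOp, Matrix.of_apply, if_neg, mul_zero, zero_mul]
    intro hxy
    refine hy ⟨fun t => y (cyc n t.val), ?_⟩
    ext1 m
    by_cases hm : ∃ t : Fin (k+1), m = cyc n t.val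
    · obtain ⟨t, rfl⟩ := hm
      rw [replaceWindow_cyc hk]
    · push Not at hm
      rw [replaceWindow_of_ne _ _ _ hm, hxy m hm]
  · rw [localOp, Matrix.of_apply, if_pos fun m hm => (replaceWindow_of_ne _ _ _ hm).symm, mul_one]
    simp only [replaceWindow_cyc hk]

lemma opSum_mulVec_mps (A : Fin d → Matrix (Fin D) (Fin D) ℂ) {k N : ℕ} (hk : k + 1 ≤ N)
    (z : Fin d) (o : Matrix (Fin (k+1) → Fin d) (Fin (k+1) → Fin d) ℂ) (ε : ℂ)
    (x : Fin N → Fin d) :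
    (opSum (N := N) o).mulVec (mps A N) x =
      ringSum A k (windowMatrix A z o ε) (List.ofFn x) + N * ε * mps A N x := by
  rw [opSum, Matrix.sum_mulVec, Finset.sum_apply]
  simp only [localOp_mulVec_mps A hk z o ε, Finset.sum_add_distrib]
  rw [ringSum, List.length_ofFn, ← Fin.sum_univ_eq_sum_range
    (fun s => headTerm A k (windowMatrix A z o ε) ((List.ofFn x).rotate s))]
  simp [mul_assoc]

lemma TransferFixedPoints.exists_right_inverse {A : Fin d → Matrix (Fin D) (Fin D) ℂ}
    {ρL ρR : Matrix (Fin D) (Fin D) ℂ} (h : TransferFixedPoints A ρL ρR) :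
    ∃ U : Fin d → Matrix (Fin D) (Fin D) ℂ, ∑ x, A x * U x = 1 := by
  obtain ⟨-, hR, -, hfix⟩ := h
  refine ⟨fun x => ρR * (A x)ᴴ * ρR⁻¹, ?_⟩
  simp only [← mul_assoc]
  rw [← Finset.sum_mul, hfix,
    Matrix.mul_nonsing_inv _ ((Matrix.isUnit_iff_isUnit_det _).1 hR.isUnit)]

lemma TransferFixedPoints.exists_left_inverse {A : Fin d → Matrix (Fin D) (Fin D) ℂ}
    {ρL ρR : Matrix (Fin D) (Fin D) ℂ} (h : TransferFixedPoints A ρL ρR) :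
    ∃ V : Fin d → Matrix (Fin D) (Fin D) ℂ, ∑ x, V x * A x = 1 := by
  obtain ⟨hL, -, hfix, -⟩ := h
  refine ⟨fun x => ρL⁻¹ * ((A x)ᴴ * ρL), ?_⟩
  simp only [mul_assoc ρL⁻¹]
  rw [← Finset.mul_sum, hfix,
    Matrix.nonsing_inv_mul _ ((Matrix.isUnit_iff_isUnit_det _).1 hL.isUnit)]

end Chain

/-- If an injective MPS (with positive definite transfer fixed
points) on `N > 2L + 2k − 1` sites is an eigenstate of `O_N` with eigenvalue `E_N`,
then for every `K ≥ k` the MPS on `K` sites is an eigenstate of `O_K` with the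
extensive eigenvalue `K · E_N / N`. -/
theorem mps_eigenstate_all_sizes
    (d D : ℕ) (hd : 1 ≤ d) (hD : 1 ≤ D)
    (A : Fin d → Matrix (Fin D) (Fin D) ℂ)
    (L : ℕ) (hinj : InjectiveLen A L)
    (ρL ρR : Matrix (Fin D) (Fin D) ℂ) (hfix : TransferFixedPoints A ρL ρR)
    (k : ℕ) (o : Matrix (Fin (k+1) → Fin d) (Fin (k+1) → Fin d) ℂ)
    (E : ℂ) (N : ℕ) (hN : 2 * L + 2 * k + 1 < N)
    (heig : (opSum (N := N) o).mulVec (mps A N) = E • mps A N) :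
    ∀ K : ℕ, k + 1 ≤ K →
      (opSum (N := K) o).mulVec (mps A K) = ((K : ℂ) * (E / (N : ℂ))) • mps A K := by
  intro K hK
  have : NeZero D := ⟨by omega⟩
  obtain ⟨U, hU⟩ := hfix.exists_right_inverse
  obtain ⟨V, hV⟩ := hfix.exists_left_inverse
  have hN0 : (N : ℂ) ≠ 0 := Nat.cast_ne_zero.2 (by omega)
  ext x
  rw [opSum_mulVec_mps A hK ⟨0, hd⟩ o (E / N),
    ringSum_eq_zero hinj hU hV (N := N) (by omega) _ (by simpa using hK), zero_add,
    Pi.smul_apply, smul_eq_mul]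
  intro l hl
  obtain ⟨i, rfl⟩ := exists_ofFn_eq hl
  have := congrFun heig i
  rwa [opSum_mulVec_mps A (by omega) ⟨0, hd⟩ o (E / N), Pi.smul_apply, smul_eq_mul,
    mul_div_cancel₀ _ hN0, add_eq_right] at this
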